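/- Let ω* = p/m with p ∈ ℤ and m ∈ ℕ*. Suppose f is an analytic function on 𝕋 = ℝ/ℤ with zero mean value, and that either f is a non-zero trigonometric polynomial, or the Fourier expansion of f contains at least one non-zero coefficient with index k ∈ mℤ. Then the difference equation u(θ+ω*, ε) − 2u(θ,ε) + u(θ−ω*, ε) = ε f(θ + u(θ,ε)) has no solution that is a formal power series in ε with analytic coefficients: there is no u = Σ_{n≥1} ε^n u_n with all u_n ∈ C^ω(𝕋) satisfying the equation as an identity of formal series in ε, where f∘(id+u) is interpreted via the formally convergent Taylor expansion Σ_{r≥0} (1/r!) f^{(r)} u^r. -/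

import Mathlib

noncomputable section

/-- The `k`-th Fourier coefficient of an analytic function on `𝕋 = ℝ/ℤ`. -/
def fc (f : ℝ → ℝ) (k : ℤ) : ℂ :=
  ∫ t in (0:ℝ)..1, (f t : ℂ) * Complex.exp (-(2 * Real.pi * Complex.I * k * t))

/-- The coefficient of `ε^n` in the formal series `ε·f∘(id+u)`, where
`u = Σ_{n≥1} ε^n u_n` and `f∘(id+u) = Σ_{r≥0} (1/r!) f^{(r)} u^r`
(the sum is over all decompositions `n−1 = n₁+⋯+n_r`; terms with some `n_i = 0`
vanish since `u 0 = 0`). -/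
def rhsCoeff (f : ℝ → ℝ) (u : ℕ → ℝ → ℝ) (n : ℕ) (θ : ℝ) : ℝ :=
  ∑ r ∈ Finset.range n, ((r.factorial : ℝ))⁻¹ * iteratedDeriv r f θ *
    ∑ c ∈ Finset.Nat.antidiagonalTuple r (n - 1), ∏ i, u (c i) θ

/-- The exponential series truncated at order `N`, with coefficients in the field `K`. -/
def truncExp (K : Type*) {A : Type*} [Field K] [CommRing A] [Algebra K A] (N : ℕ) (a : A) : A :=
  ∑ r ∈ Finset.range N, ((r.factorial : K)⁻¹) • a ^ r

section TruncExp

variable {K A : Type*} [Field K] [CommRing A] [Algebra K A]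

lemma truncExp_zero {N : ℕ} (hN : 0 < N) : truncExp K N (0 : A) = 1 := by
  obtain ⟨N, rfl⟩ := Nat.exists_eq_succ_of_ne_zero hN.ne'
  simp [truncExp, Finset.sum_range_succ']

lemma dvd_truncExp_sub {q a b : A} (N : ℕ) (h : q ∣ a - b) :
    q ∣ truncExp K N a - truncExp K N b := by
  rw [truncExp, truncExp, ← Finset.sum_sub_distrib]
  refine Finset.dvd_sum fun r _ => ?_
  rw [← smul_sub]
  exact dvd_smul_of_dvd _ (h.trans (sub_dvd_pow_sub_pow a b r))

lemma map_truncExp {B F : Type*} (K' : Type*) [Field K'] [CommRing B] [Algebra K' B]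
    [FunLike F A B] [RingHomClass F A B] (φ : F) (N : ℕ) (a : A) :
    φ (truncExp K N a) = truncExp K' N (φ a) := by
  simp [truncExp, map_inv_natCast_smul φ K K']

/-- The functional equation of the exponential, modulo `x ^ N`. -/
lemma dvd_truncExp_add_sub [CharZero K] {x a b : A} (N : ℕ) (ha : x ∣ a) (hb : x ∣ b) :
    x ^ N ∣ truncExp K N (a + b) - truncExp K N a * truncExp K N b := by
  rw [← Ideal.mem_span_singleton, ← Ideal.Quotient.mk_eq_mk_iff_sub_mem]
  set I := Ideal.span {x ^ N}
  let _ : Algebra ℚ A := Algebra.compHom A (algebraMap ℚ K)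
  have key : ∀ c : A, x ∣ c → (Ideal.Quotient.mk I c) ^ N = 0 ∧
      Ideal.Quotient.mk I (truncExp K N c) = IsNilpotent.exp (Ideal.Quotient.mk I c) := by
    intro c hc
    have h0 : (Ideal.Quotient.mk I c) ^ N = 0 := by
      rw [← map_pow, Ideal.Quotient.eq_zero_iff_mem, Ideal.mem_span_singleton]
      exact pow_dvd_pow_of_dvd hc N
    refine ⟨h0, ?_⟩
    rw [IsNilpotent.exp_eq_sum h0, truncExp, map_sum]
    refine Finset.sum_congr rfl fun r _ => ?_
    have : ((r.factorial : K)⁻¹) • c ^ r = ((r.factorial : ℚ)⁻¹) • c ^ r := by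
      rw [Algebra.smul_def, Algebra.smul_def]
      congr 1
      change _ = algebraMap K A (algebraMap ℚ K _)
      simp
    rw [this, ← map_pow]
    rfl
  rw [map_mul, (key _ (dvd_add ha hb)).2, (key a ha).2, (key b hb).2, map_add]
  exact IsNilpotent.exp_add_of_commute (Commute.all _ _) ⟨N, (key a ha).1⟩ ⟨N, (key b hb).1⟩

/-- `exp (l • a)` is the `l`-th power of `exp a`, modulo `x ^ N`. -/
lemma dvd_truncExp_nsmul_sub [CharZero K] {x a : A} {N : ℕ} (hN : 0 < N) (ha : x ∣ a) (l : ℕ) :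
    x ^ N ∣ truncExp K N (l • a) - truncExp K N a ^ l := by
  induction l with
  | zero => simp [truncExp_zero hN]
  | succ l ih =>
    have h1 := dvd_truncExp_add_sub (K := K) N (dvd_smul_of_dvd l ha) ha
    have h2 := h1.add (ih.mul_right (truncExp K N a))
    rw [succ_nsmul]
    convert h2 using 1
    ring

end TruncExp

/-- The second difference along a cyclic sequence. -/
def cyclicLaplacian {m : ℕ} {A : Type*} [AddCommGroup A] (w : ZMod m → A) (j : ZMod m) : A :=
  w (j + 1) - w j - (w j - w (j - 1))

section Laplacian

variable {m : ℕ} [NeZero m]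

lemma eq_const_of_succ_eq {A : Type*} (v : ZMod m → A) (h : ∀ j, v (j + 1) = v j) (j : ZMod m) :
    v j = v 0 := by
  rw [← ZMod.natCast_zmod_val j]
  induction j.val with
  | zero => simp
  | succ n ih => rw [Nat.cast_succ, h, ih]

lemma sum_cyclicLaplacian {A : Type*} [AddCommGroup A] (w : ZMod m → A) :
    ∑ j, cyclicLaplacian w j = 0 := by
  have h1 : ∑ j, w (j + 1) = ∑ j, w j := Equiv.sum_comp (Equiv.addRight (1 : ZMod m)) w
  have h2 : ∑ j, w (j - 1) = ∑ j, w j := Equiv.sum_comp (Equiv.subRight (1 : ZMod m)) w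
  simp [cyclicLaplacian, Finset.sum_sub_distrib, h1, h2]

/-- On sequences of zero sum, the cyclic second difference has a left inverse given by a matrix
with complex entries. -/
lemma exists_cyclicLaplacian_inverse (m : ℕ) [NeZero m] :
    ∃ K : ZMod m → ZMod m → ℂ, ∀ (A : Type) [CommRing A] [Algebra ℂ A] (w : ZMod m → A),
      ∑ j, w j = 0 → ∀ j, w j = ∑ l, K j l • cyclicLaplacian w l := by
  let M : Matrix (ZMod m) (ZMod m) ℂ := Matrix.of fun j l =>
    (if j + 1 = l then 1 else 0) - (if j = l then 1 else 0)
      - ((if j = l then 1 else 0) - (if j - 1 = l then 1 else 0)) + 1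
  have hM : ∀ (A : Type) [CommRing A] [Algebra ℂ A] (w : ZMod m → A) (j),
      ∑ l, M j l • w l = cyclicLaplacian w j + ∑ l, w l := by
    intro A _ _ w j
    simp [M, cyclicLaplacian, add_smul, sub_smul, ite_smul, Finset.sum_add_distrib,
      Finset.sum_sub_distrib]
  have hm : (m : ℂ) ≠ 0 := Nat.cast_ne_zero.2 (NeZero.ne m)
  have hunit : IsUnit M := by
    rw [← Matrix.mulVec_injective_iff_isUnit, ← Matrix.coe_mulVecLin, injective_iff_map_eq_zero']
    intro v
    refine ⟨fun hv => ?_, fun hv => by simp [hv]⟩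
    have hv' : ∀ j, cyclicLaplacian v j + ∑ l, v l = 0 := fun j => by
      rw [← hM ℂ v j]
      exact congrFun hv j
    have hs : ∑ l, v l = 0 := by
      have := Finset.sum_congr (rfl : (Finset.univ : Finset (ZMod m)) = Finset.univ)
        (fun j _ => hv' j)
      rw [Finset.sum_add_distrib, sum_cyclicLaplacian] at this
      simpa [ZMod.card, hm] using this
    have hd : ∀ j, v (j + 1) - v j = v (0 + 1) - v 0 := by
      refine eq_const_of_succ_eq (fun j => v (j + 1) - v j) fun j => ?_
      have := hv' (j + 1)
      rw [hs, cyclicLaplacian, add_zero, add_sub_cancel_right] at this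
      exact sub_eq_zero.1 this
    have hd0 : v (0 + 1) - v 0 = 0 := by
      have h1 : ∑ j, (v (j + 1) - v j) = 0 := by
        rw [Finset.sum_sub_distrib]
        exact sub_eq_zero.2 (Equiv.sum_comp (Equiv.addRight (1 : ZMod m)) v)
      rw [Finset.sum_congr rfl fun j _ => hd j] at h1
      rw [Finset.sum_const, Finset.card_univ, ZMod.card, nsmul_eq_mul] at h1
      exact (mul_eq_zero.1 h1).resolve_left hm
    have hc := eq_const_of_succ_eq v fun j => sub_eq_zero.1 ((hd j).trans hd0)
    rw [Finset.sum_congr rfl fun j _ => hc j] at hs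
    have h0 : v 0 = 0 := by simpa [ZMod.card, hm] using hs
    exact funext fun j => (hc j).trans h0
  refine ⟨fun j l => M⁻¹ j l, fun A _ _ w hw j => ?_⟩
  have h1 : ∀ l, cyclicLaplacian w l = ∑ i, M l i • w i := fun l => by rw [hM, hw, add_zero]
  simp_rw [h1, Finset.smul_sum, smul_smul]
  rw [Finset.sum_comm]
  simp_rw [← Finset.sum_smul]
  have h2 : ∀ i, ∑ l, M⁻¹ j l * M l i = if j = i then 1 else 0 := fun i => by
    rw [← Matrix.mul_apply, Matrix.nonsing_inv_mul _ ((Matrix.isUnit_iff_isUnit_det _).1 hunit),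
      Matrix.one_apply]
  simp [h2, ite_smul]

end Laplacian

/-- The family of truncated exponential sums `∑ l, γ j l Y ^ l exp (κ l w)`. -/
def expSum {ι A : Type*} [CommRing A] [Algebra ℂ A] (γ : ι → ℕ → ℂ) (κ : ℕ → ℂ) (L N : ℕ)
    (Y : A) (j : ι) (w : A) : A :=
  ∑ l ∈ Finset.range L, γ j l • (Y ^ l * truncExp ℂ N (κ l • w))

section ExpSum

variable {ι A : Type*} [CommRing A] [Algebra ℂ A] (γ : ι → ℕ → ℂ) (κ : ℕ → ℂ) (L N : ℕ)

lemma dvd_expSum_sub {q a b : A} (Y : A) (j : ι) (h : q ∣ a - b) :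
    q ∣ expSum γ κ L N Y j a - expSum γ κ L N Y j b := by
  rw [expSum, expSum, ← Finset.sum_sub_distrib]
  refine Finset.dvd_sum fun l _ => ?_
  rw [← smul_sub, ← mul_sub]
  refine dvd_smul_of_dvd _ (Dvd.dvd.mul_left (dvd_truncExp_sub N ?_) _)
  rw [← smul_sub]
  exact dvd_smul_of_dvd _ h

lemma map_expSum {B : Type*} [CommRing B] [Algebra ℂ B] (φ : A →ₐ[ℂ] B) (Y : A) (j : ι) (w : A) :
    φ (expSum γ κ L N Y j w) = expSum γ κ L N (φ Y) j (φ w) := by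
  simp [expSum, map_truncExp (K := ℂ) ℂ φ]

/-- Algebra homomorphisms from `ℂ[Y][z]` given by the images of `Y` and `z`. -/
def evalTwo (Y z : A) : Polynomial (Polynomial ℂ) →ₐ[ℂ] A :=
  { Polynomial.eval₂RingHom (Polynomial.aeval (R := ℂ) Y).toRingHom z with
    commutes' := fun c => by
      rw [Polynomial.algebraMap_apply]
      simp [← Polynomial.algebraMap_eq] }

lemma evalTwo_X (Y z : A) : evalTwo Y z Polynomial.X = z := by simp [evalTwo]

lemma evalTwo_C (Y z : A) (p : Polynomial ℂ) :
    evalTwo Y z (Polynomial.C p) = Polynomial.aeval Y p := by simp [evalTwo]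

end ExpSum

/-- Normalised solutions of the cyclic second difference equation are, to any order, the
specialisations of universal polynomials in two indeterminates. -/
lemma exists_universal_solution {m : ℕ} [NeZero m] (γ : ZMod m → ℕ → ℂ) (κ : ℕ → ℂ) (L N n : ℕ) :
    ∃ P : ZMod m → Polynomial (Polynomial ℂ), ∀ (A : Type) [CommRing A] [Algebra ℂ A]
      (Y z : A) (w : ZMod m → A), ∑ j, w j = 0 →
      (∀ j, z ^ n ∣ cyclicLaplacian w j - z * expSum γ κ L N Y j (w j)) →
      ∀ j, z ^ n ∣ w j - evalTwo Y z (P j) := by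
  obtain ⟨K, hK⟩ := exists_cyclicLaplacian_inverse m
  induction n with
  | zero => exact ⟨0, fun A _ _ Y z w _ _ j => by simp⟩
  | succ n ih =>
    obtain ⟨P, hP⟩ := ih
    refine ⟨fun j => ∑ l, K j l •
      (Polynomial.X * expSum γ κ L N (Polynomial.C Polynomial.X) l (P l)),
      fun A _ _ Y z w hw h j => ?_⟩
    have hPw := hP A Y z w hw fun j => (pow_dvd_pow z n.le_succ).trans (h j)
    rw [hK A w hw j, map_sum, ← Finset.sum_sub_distrib]
    refine Finset.dvd_sum fun l _ => ?_
    rw [map_smul, ← smul_sub, map_mul, evalTwo_X, map_expSum, evalTwo_C, Polynomial.aeval_X]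
    refine dvd_smul_of_dvd _ ?_
    have h1 := mul_dvd_mul_left z (dvd_expSum_sub γ κ L N Y l (hPw l))
    rw [← pow_succ'] at h1
    convert (h l).add h1 using 1
    ring

/-- A polynomial in `Y` and `z` all of whose specialisations along a family of curves, of order one
in `z` and with infinitely many origins, vanish to order `M`, is divisible by `z ^ M`. -/
lemma X_pow_dvd_of_evalTwo {Θ : Type*} (Y z : Θ → PowerSeries ℂ) (G : Polynomial (Polynomial ℂ))
    (M : ℕ) (hY : (Set.range fun t => PowerSeries.constantCoeff (Y t)).Infinite)
    (hz : ∀ t, Associated PowerSeries.X (z t))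
    (hG : ∀ t, PowerSeries.X ^ M ∣ evalTwo (Y t) (z t) G) : Polynomial.X ^ M ∣ G := by
  suffices ∀ n ≤ M, Polynomial.X ^ n ∣ G from this M le_rfl
  intro n
  induction n with
  | zero => simp
  | succ n ih =>
    intro hn
    obtain ⟨H, rfl⟩ := ih (by omega)
    rw [pow_succ]
    refine mul_dvd_mul_left _ ?_
    rw [Polynomial.X_dvd_iff]
    refine Polynomial.eq_zero_of_infinite_isRoot _ (hY.mono ?_)
    rintro _ ⟨t, rfl⟩
    have h1 : PowerSeries.X ∣ evalTwo (Y t) (z t) H := by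
      have h2 := hG t
      rw [map_mul, map_pow, evalTwo_X] at h2
      have h3 := (pow_dvd_pow _ hn).trans h2
      rw [((hz t).pow_pow (n := n + 1)).dvd_iff_dvd_left, pow_succ] at h3
      rw [(hz t).dvd_iff_dvd_left]
      refine (mul_dvd_mul_iff_left (pow_ne_zero n ?_)).1 h3
      exact (hz t).ne_zero_iff.1 PowerSeries.X_ne_zero
    rw [PowerSeries.X_dvd_iff] at h1
    have hz0 : PowerSeries.constantCoeff (z t) = 0 := by
      rw [← PowerSeries.X_dvd_iff]
      exact (hz t).dvd
    obtain ⟨H', hH'⟩ := Polynomial.X_dvd_sub_C (p := H)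
    have h4 : H = Polynomial.C (H.coeff 0) + Polynomial.X * H' := by rw [← hH']; ring
    rw [h4, map_add, map_mul, evalTwo_X, evalTwo_C, map_add, map_mul, hz0, zero_mul, add_zero,
      Polynomial.aeval_def, Polynomial.hom_eval₂] at h1
    change Polynomial.eval _ _ = 0
    rw [← h1, Polynomial.eval₂_eq_eval_map]
    congr 1
    refine (Polynomial.map_id).symm.trans ?_
    congr 1

section SemiStandard

lemma coeff_truncExp_pos {h : PowerSeries ℝ} (h0 : ∀ i, 0 ≤ PowerSeries.coeff i h) {N i : ℕ}
    (hN : 2 ≤ N) (hi : i = 0 ∨ 0 < PowerSeries.coeff i h) :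
    0 < PowerSeries.coeff i (truncExp ℝ N h) := by
  have hpow : ∀ r i, 0 ≤ PowerSeries.coeff i (h ^ r) := by
    intro r
    induction r with
    | zero => intro i; rw [pow_zero, PowerSeries.coeff_one]; split_ifs <;> simp
    | succ r ih =>
      intro i
      rw [pow_succ, PowerSeries.coeff_mul]
      exact Finset.sum_nonneg fun p _ => mul_nonneg (ih _) (h0 _)
  rw [truncExp, map_sum]
  refine Finset.sum_pos' (fun r _ => ?_) ?_
  · rw [map_smul, smul_eq_mul]
    exact mul_nonneg (by positivity) (hpow r i)
  · rcases hi with rfl | hi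
    · exact ⟨0, Finset.mem_range.2 (by omega), by simp⟩
    · exact ⟨1, Finset.mem_range.2 (by omega), by simpa using hi⟩

/-- The coefficients of the formal solution of the semi-standard equation with positive
divisors `δ` are positive. -/
lemma exists_semiStandard_solution (δ : ℕ → ℝ) {N : ℕ} (hN : 2 ≤ N) (M : ℕ)
    (hδ : ∀ i, 1 ≤ i → i < M + 1 → 0 < δ i) :
    ∃ h : PowerSeries ℝ, PowerSeries.coeff 0 h = 0 ∧ (∀ i, M + 1 ≤ i → PowerSeries.coeff i h = 0) ∧
      (∀ i, 1 ≤ i → i < M + 1 →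
        δ i * PowerSeries.coeff i h = PowerSeries.coeff (i - 1) (truncExp ℝ N h)) ∧
      0 < PowerSeries.coeff M (truncExp ℝ N h) := by
  suffices ∃ h : PowerSeries ℝ, PowerSeries.coeff 0 h = 0 ∧
      (∀ i, M + 1 ≤ i → PowerSeries.coeff i h = 0) ∧ (∀ i, 0 ≤ PowerSeries.coeff i h) ∧
      (∀ i, 1 ≤ i → i < M + 1 → 0 < PowerSeries.coeff i h ∧
        δ i * PowerSeries.coeff i h = PowerSeries.coeff (i - 1) (truncExp ℝ N h)) by
    obtain ⟨h, h1, h2, h3, h4⟩ := this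
    refine ⟨h, h1, h2, fun i hi hi' => (h4 i hi hi').2, coeff_truncExp_pos h3 hN ?_⟩
    rcases Nat.eq_zero_or_pos M with hM | hM
    · exact Or.inl hM
    · exact Or.inr (h4 M hM (by omega)).1
  induction M with
  | zero => exact ⟨0, by simp, by simp, by simp, fun i hi hi' => by omega⟩
  | succ M ih =>
    obtain ⟨h, h1, h2, h3, h4⟩ := ih fun i hi hi' => hδ i hi (by omega)
    have hT : 0 < PowerSeries.coeff M (truncExp ℝ N h) := by
      refine coeff_truncExp_pos h3 hN ?_
      rcases Nat.eq_zero_or_pos M with hM | hM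
      · exact Or.inl hM
      · exact Or.inr (h4 M hM (by omega)).1
    have hd := hδ (M + 1) (by omega) (by omega)
    set c := PowerSeries.coeff M (truncExp ℝ N h) / δ (M + 1) with hc
    have hc0 : 0 < c := div_pos hT hd
    have hcoeff : ∀ i, PowerSeries.coeff i (h + PowerSeries.monomial (M + 1) c) =
        PowerSeries.coeff i h + if i = M + 1 then c else 0 := fun i => by
      rw [map_add, PowerSeries.coeff_monomial]
    have hTc : ∀ i < M + 1, PowerSeries.coeff i
        (truncExp ℝ N (h + PowerSeries.monomial (M + 1) c)) =
        PowerSeries.coeff i (truncExp ℝ N h) := fun i hi => by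
      rw [← sub_eq_zero, ← map_sub]
      refine PowerSeries.X_pow_dvd_iff.1 (dvd_truncExp_sub N ?_) i hi
      rw [add_sub_cancel_left, PowerSeries.X_pow_dvd_iff]
      intro k hk
      rw [PowerSeries.coeff_monomial, if_neg hk.ne]
    refine ⟨h + PowerSeries.monomial (M + 1) c, ?_, fun i hi => ?_, fun i => ?_, fun i hi hi' => ?_⟩
    · rw [hcoeff, h1, if_neg (by omega), add_zero]
    · rw [hcoeff, h2 i (by omega), if_neg (by omega), add_zero]
    · rw [hcoeff]
      have := h3 i
      split_ifs <;> positivity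
    · rw [hTc _ (by omega), hcoeff]
      rcases Nat.lt_or_ge i (M + 1) with hlt | hge
      · rw [if_neg (by omega), add_zero]
        exact h4 i hi hlt
      · obtain rfl : i = M + 1 := by omega
        rw [h2 _ le_rfl, if_pos rfl, zero_add, Nat.add_sub_cancel, hc]
        exact ⟨hc0, mul_div_cancel₀ _ hd.ne'⟩

lemma pow_val_add_one {m : ℕ} [NeZero m] {η : ℂ} (hη : η ^ m = 1) (j : ZMod m) :
    η ^ (j + 1).val = η ^ j.val * η := by
  rw [ZMod.val_add, ← pow_eq_pow_mod _ hη, pow_add, ZMod.val_one_eq_one_mod,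
    ← pow_eq_pow_mod _ hη, pow_one]

lemma sum_pow_val_pow {m : ℕ} [NeZero m] {η : ℂ} (hη : η ^ m = 1) {i : ℕ} (hi : η ^ i ≠ 1) :
    ∑ j : ZMod m, (η ^ j.val) ^ i = 0 := by
  have h := Equiv.sum_comp (Equiv.addRight (1 : ZMod m)) fun j => (η ^ j.val) ^ i
  simp only [Equiv.coe_addRight, pow_val_add_one hη, mul_pow] at h
  rw [← Finset.sum_mul] at h
  by_contra h0
  exact hi (mul_left_cancel₀ h0 (h.trans (mul_one _).symm))

lemma expSum_zero_left {ι A : Type*} [CommRing A] [Algebra ℂ A] (γ : ι → ℕ → ℂ) (κ : ℕ → ℂ)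
    {L : ℕ} (hL : 0 < L) (N : ℕ) (j : ι) (w : A) :
    expSum γ κ L N 0 j w = γ j 0 • truncExp ℂ N (κ 0 • w) := by
  obtain ⟨L, rfl⟩ := Nat.exists_eq_succ_of_ne_zero hL.ne'
  simp [expSum, Finset.sum_range_succ']

/-- The semi-standard cyclic equation has a normalised approximate solution up to the order of the
root of unity `η`, at which order its average does not vanish. -/
lemma exists_semiStandard_cyclic {m : ℕ} [NeZero m] {η b : ℂ} (hη : η ^ m = 1) (hb : b ≠ 0)
    (γ : ZMod m → ℕ → ℂ) (κ : ℕ → ℂ) (hγ : ∀ j, γ j 0 = b * η ^ j.val) (hκ : κ 0 ≠ 0)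
    {L N : ℕ} (hL : 0 < L) (hN : 2 ≤ N) :
    ∃ w : ZMod m → PowerSeries ℂ, ∑ j, w j = 0 ∧
      (∀ j, PowerSeries.X ^ orderOf η ∣
        cyclicLaplacian w j - PowerSeries.X * expSum γ κ L N 0 j (w j)) ∧
      PowerSeries.coeff (orderOf η - 1) (∑ j, expSum γ κ L N 0 j (w j)) ≠ 0 := by
  have hm : 0 < m := Nat.pos_of_ne_zero (NeZero.ne m)
  have hη0 : η ≠ 0 := by
    rintro rfl
    simp [hm.ne'] at hη
  obtain ⟨M, hM⟩ : ∃ M, orderOf η = M + 1 := Nat.exists_eq_succ_of_ne_zero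
    (orderOf_pos_iff.2 (isOfFinOrder_iff_pow_eq_one.2 ⟨m, hm, hη⟩)).ne'
  have hne : ∀ i, 1 ≤ i → i < M + 1 → η ^ i ≠ 1 := fun i hi hi' =>
    pow_ne_one_of_lt_orderOf (by omega) (by omega)
  have hnorm : ∀ i, ‖η ^ i‖ = 1 := fun i => by
    rw [norm_pow, Complex.norm_eq_one_of_pow_eq_one hη hm.ne', one_pow]
  have hδ : ∀ i, 1 ≤ i → i < M + 1 → 0 < 2 - 2 * (η ^ i).re := by
    intro i hi hi'
    have h1 : (η ^ i).re ≤ 1 := (Complex.re_le_norm _).trans (hnorm i).le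
    have h2 : (η ^ i).re ≠ 1 := by
      intro h
      have h3 := Complex.normSq_eq_norm_sq (η ^ i)
      rw [hnorm, Complex.normSq_apply, h] at h3
      exact hne i hi hi' (Complex.ext h (by simpa using h3))
    have := lt_of_le_of_ne h1 h2
    linarith
  have hδ' : ∀ i, η ^ i + (η⁻¹) ^ i - 2 = -((2 - 2 * (η ^ i).re : ℝ) : ℂ) := by
    intro i
    have h1 : (η⁻¹) ^ i = (starRingEnd ℂ) (η ^ i) := by
      rw [inv_pow, Complex.inv_eq_conj (hnorm i)]
    rw [h1, Complex.add_conj]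
    push_cast
    ring
  obtain ⟨h, h0, hh, hrec, hpos⟩ := exists_semiStandard_solution _ hN M hδ
  set μ := -(κ 0 * b) with hμ
  have hμ0 : μ ≠ 0 := neg_ne_zero.2 (mul_ne_zero hκ hb)
  set H := PowerSeries.map Complex.ofRealHom h with hH
  let w : ZMod m → PowerSeries ℂ := fun j => (κ 0)⁻¹ • PowerSeries.rescale (μ * η ^ j.val) H
  have hw : ∀ j i, PowerSeries.coeff i (w j) =
      (κ 0)⁻¹ * (μ ^ i * (η ^ j.val) ^ i * ((PowerSeries.coeff i h : ℝ) : ℂ)) := fun j i => by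
    simp [w, hH, PowerSeries.coeff_rescale, mul_pow]
  have hF : ∀ j i, PowerSeries.coeff i (expSum γ κ L N 0 j (w j)) =
      b * η ^ j.val * (μ ^ i * (η ^ j.val) ^ i * ((PowerSeries.coeff i (truncExp ℝ N h) : ℝ) : ℂ)) := by
    intro j i
    rw [expSum_zero_left γ κ hL, smul_smul, mul_inv_cancel₀ hκ, one_smul,
      ← map_truncExp (K := ℂ) ℂ, hH, ← map_truncExp (K := ℝ) ℂ, hγ]
    simp [PowerSeries.coeff_rescale, mul_pow]
  refine ⟨w, ?_, fun j => ?_, ?_⟩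
  · ext i
    rw [map_sum, map_zero]
    simp_rw [hw]
    rcases Nat.eq_zero_or_pos i with rfl | hi
    · simp [h0]
    rcases Nat.lt_or_ge i (M + 1) with hi' | hi'
    · have := sum_pow_val_pow hη (hne i hi hi')
      rw [← Finset.mul_sum, ← Finset.sum_mul, ← Finset.mul_sum, this]
      simp
    · simp [hh i hi']
  · rw [PowerSeries.X_pow_dvd_iff, hM]
    intro i hi'
    have e1 := pow_val_add_one hη j
    have e2 : η ^ (j - 1).val = η ^ j.val * η⁻¹ := by
      have := pow_val_add_one hη (j - 1)
      rw [sub_add_cancel] at this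
      rw [this, mul_assoc, mul_inv_cancel₀ hη0, mul_one]
    rcases Nat.eq_zero_or_pos i with rfl | hi
    · simp only [cyclicLaplacian, map_sub, hw, h0, PowerSeries.coeff_zero_X_mul]
      simp
    obtain ⟨i, rfl⟩ := Nat.exists_eq_succ_of_ne_zero hi.ne'
    have e3 := congrArg (fun x : ℝ => (x : ℂ)) (hrec _ hi hi')
    simp only [Nat.succ_eq_add_one, Nat.add_sub_cancel, Complex.ofReal_mul] at e3
    simp only [cyclicLaplacian, map_sub, Nat.succ_eq_add_one, PowerSeries.coeff_succ_X_mul, hw, hF,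
      e1, e2, ← e3]
    have e4 := hδ' (i + 1)
    rw [mul_pow, mul_pow, ← neg_eq_iff_eq_neg.2 e4, pow_succ μ]
    have e5 : (κ 0)⁻¹ * μ = -b := by
      rw [hμ]; field_simp
    linear_combination (μ ^ i * (η ^ j.val) ^ (i + 1) * ((PowerSeries.coeff (i + 1) h : ℝ) : ℂ)
      * (η ^ (i + 1) + η⁻¹ ^ (i + 1) - 2)) * e5
  · rw [map_sum, hM, Nat.add_sub_cancel]
    simp_rw [hF]
    have e1 : ∀ j : ZMod m, η ^ j.val * (η ^ j.val) ^ M = 1 := fun j => by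
      rw [← pow_succ', ← pow_mul, mul_comm, pow_mul, ← hM, pow_orderOf_eq_one, one_pow]
    have e2 : ∀ j : ZMod m, b * η ^ j.val *
        (μ ^ M * (η ^ j.val) ^ M * ((PowerSeries.coeff M (truncExp ℝ N h) : ℝ) : ℂ)) =
        b * μ ^ M * ((PowerSeries.coeff M (truncExp ℝ N h) : ℝ) : ℂ) := fun j => by
      linear_combination (b * μ ^ M * ((PowerSeries.coeff M (truncExp ℝ N h) : ℝ) : ℂ)) * e1 j
    rw [Finset.sum_congr rfl fun j _ => e2 j, Finset.sum_const, Finset.card_univ, ZMod.card,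
      nsmul_eq_mul]
    exact mul_ne_zero (NeZero.ne _) (mul_ne_zero (mul_ne_zero hb (pow_ne_zero _ hμ0))
      (Complex.ofReal_ne_zero.2 hpos.ne'))

end SemiStandard

/-- There is no family of normalised cyclic solutions, modulo high powers of the formal parameter,
of an equation with trigonometric polynomial nonlinearity whose top harmonic does not vanish. -/
lemma no_normalised_cyclic_family {m : ℕ} [NeZero m] {η b : ℂ} (hη : η ^ m = 1) (hb : b ≠ 0)
    (γ : ZMod m → ℕ → ℂ) (κ : ℕ → ℂ) (hγ : ∀ j, γ j 0 = b * η ^ j.val) (hκ : κ 0 ≠ 0)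
    {L N : ℕ} (hL : 0 < L) (hN : 2 ≤ N) {Θ : Type*} (Y z : Θ → PowerSeries ℂ)
    (hY : (Set.range fun t => PowerSeries.constantCoeff (Y t)).Infinite)
    (hz : ∀ t, Associated PowerSeries.X (z t))
    (w : Θ → ZMod m → PowerSeries ℂ) (hw : ∀ t, ∑ j, w t j = 0) :
    ¬ ∀ t j, PowerSeries.X ^ (orderOf η + 1) ∣
      cyclicLaplacian (w t) j - z t * expSum γ κ L N (Y t) j (w t j) := by
  intro h
  have hord : 0 < orderOf η := orderOf_pos_iff.2
    (isOfFinOrder_iff_pow_eq_one.2 ⟨m, Nat.pos_of_ne_zero (NeZero.ne m), hη⟩)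
  obtain ⟨P, hP⟩ := exists_universal_solution γ κ L N (orderOf η)
  set G := ∑ j, expSum γ κ L N (Polynomial.C Polynomial.X) j (P j) with hG
  have hGmap : ∀ y x : PowerSeries ℂ, evalTwo y x G = ∑ j, expSum γ κ L N y j (evalTwo y x (P j)) :=
    fun y x => by
      rw [hG, map_sum]
      simp_rw [map_expSum, evalTwo_C, Polynomial.aeval_X]
  have hGw : ∀ (y x : PowerSeries ℂ) (v : ZMod m → PowerSeries ℂ), ∑ j, v j = 0 →
      (∀ j, x ^ orderOf η ∣ cyclicLaplacian v j - x * expSum γ κ L N y j (v j)) →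
      x ^ orderOf η ∣ ∑ j, expSum γ κ L N y j (v j) - evalTwo y x G := by
    intro y x v hv hv'
    rw [hGmap, ← Finset.sum_sub_distrib]
    exact Finset.dvd_sum fun j _ => dvd_expSum_sub γ κ L N y j (hP _ y x v hv hv' j)
  have hGX : Polynomial.X ^ orderOf η ∣ G := by
    refine X_pow_dvd_of_evalTwo Y z G _ hY hz fun t => ?_
    have h1 := Finset.dvd_sum fun j (_ : j ∈ Finset.univ) => h t j
    rw [Finset.sum_sub_distrib, sum_cyclicLaplacian, zero_sub, dvd_neg, ← Finset.mul_sum,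
      ((hz t).pow_pow (n := orderOf η + 1)).dvd_iff_dvd_left, pow_succ', mul_dvd_mul_iff_left
        ((hz t).ne_zero_iff.1 PowerSeries.X_ne_zero)] at h1
    have h2 := hGw (Y t) (z t) (w t) (hw t) fun j => by
      rw [← ((hz t).pow_pow (n := orderOf η)).dvd_iff_dvd_left]
      exact (pow_dvd_pow _ (Nat.le_succ _)).trans (h t j)
    rw [((hz t).pow_pow (n := orderOf η)).dvd_iff_dvd_left]
    exact (dvd_sub_right h1).1 h2
  obtain ⟨v, hv, hv', hne⟩ := exists_semiStandard_cyclic hη hb γ κ hγ hκ hL hN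
  have h1 := map_dvd (evalTwo (0 : PowerSeries ℂ) PowerSeries.X) hGX
  rw [map_pow, evalTwo_X] at h1
  have h2 := (dvd_sub_left h1).1 (hGw 0 PowerSeries.X v hv hv')
  exact hne (PowerSeries.X_pow_dvd_iff.1 h2 _ (by omega))

section Fourier

lemma continuous_periodic_lift {g : ℝ → ℂ} (hg : Continuous g) (hper : Function.Periodic g 1) :
    Continuous (hper.lift : AddCircle (1 : ℝ) → ℂ) :=
  hg.quotient_lift _

lemma fc_eq_fourierCoeff {f : ℝ → ℝ} (hper : Function.Periodic (fun x => (f x : ℂ)) 1) (k : ℤ) :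
    fc f k = fourierCoeff (hper.lift : AddCircle (1 : ℝ) → ℂ) k := by
  rw [fourierCoeff_eq_intervalIntegral _ k 0, fc]
  simp only [div_one, one_smul, zero_add]
  refine intervalIntegral.integral_congr fun t _ => ?_
  change _ = fourier (-k) (t : AddCircle (1 : ℝ)) • (f t : ℂ)
  rw [fourier_coe_apply, smul_eq_mul, mul_comm]
  congr 2
  push_cast
  ring

lemma fc_neg (f : ℝ → ℝ) (k : ℤ) : fc f (-k) = (starRingEnd ℂ) (fc f k) := by
  rw [fc, fc, intervalIntegral.integral_of_le zero_le_one,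
    intervalIntegral.integral_of_le zero_le_one, ← integral_conj]
  congr 1
  ext t
  rw [map_mul, Complex.conj_ofReal, ← Complex.exp_conj]
  congr 2
  simp only [map_neg, map_mul, Complex.conj_ofReal, Complex.conj_I, map_intCast, map_ofNat]
  push_cast
  ring

/-- A trigonometric polynomial is the sum of its finite Fourier series. -/
lemma eq_sum_fc {f : ℝ → ℝ} (hf : Continuous f) (hper : ∀ x, f (x + 1) = f x) {s : Finset ℤ}
    (hs : ∀ k ∉ s, fc f k = 0) (x : ℝ) :
    (f x : ℂ) = ∑ k ∈ s, fc f k * Complex.exp (2 * Real.pi * Complex.I * k * x) := by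
  have hper' : Function.Periodic (fun x => (f x : ℂ)) 1 := fun x => by simp [hper x]
  let g : C(AddCircle (1 : ℝ), ℂ) :=
    ⟨hper'.lift, continuous_periodic_lift (Complex.continuous_ofReal.comp hf) hper'⟩
  have hg : ∀ k, fourierCoeff g k = fc f k := fun k => (fc_eq_fourierCoeff hper' k).symm
  have hsum : Summable (fourierCoeff g) :=
    summable_of_ne_finset_zero (s := s) fun k hk => (hg k).trans (hs k hk)
  have h1 := (has_pointwise_sum_fourier_series_of_summable hsum (x : AddCircle (1 : ℝ))).unique
    (hasSum_sum_of_ne_finset_zero (s := s) fun k hk => by rw [hg, hs k hk, zero_smul])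
  change (f x : ℂ) = _ at h1
  rw [h1]
  refine Finset.sum_congr rfl fun k _ => ?_
  rw [hg, fourier_coe_apply, smul_eq_mul]
  congr 2
  push_cast
  ring

/-- A nonzero trigonometric polynomial of mean zero has a positive degree. -/
lemma exists_top_harmonic {f : ℝ → ℝ} (hf : Continuous f) (hper : ∀ x, f (x + 1) = f x)
    (hmean : (∫ t in (0 : ℝ)..1, f t) = 0) (hN : ∃ N : ℕ, ∀ k : ℤ, (N : ℤ) < |k| → fc f k = 0)
    (hne : ∃ x, f x ≠ 0) :
    ∃ d : ℕ, 0 < d ∧ fc f d ≠ 0 ∧ ∀ x : ℝ, (f x : ℂ) = ∑ l ∈ Finset.range (2 * d + 1),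
      fc f (d - l) * Complex.exp (2 * Real.pi * Complex.I * (d - l) * x) := by
  classical
  have hd := Nat.find_spec hN
  set d := Nat.find hN with hd_def
  have h0 : fc f 0 = 0 := by
    have : fc f 0 = ((∫ t in (0 : ℝ)..1, f t : ℝ) : ℂ) := by
      rw [fc, ← intervalIntegral.integral_ofReal]
      simp
    rw [this, hmean, Complex.ofReal_zero]
  have hrep := eq_sum_fc hf hper (s := Finset.Icc (-(d : ℤ)) d) fun k hk => hd k <| by
    rw [Finset.mem_Icc, ← abs_le] at hk
    exact not_le.1 hk
  have hdpos : 0 < d := by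
    by_contra hd0
    obtain ⟨x, hx⟩ := hne
    have hd0' : d = 0 := by omega
    have := hrep x
    rw [hd0'] at this
    exact hx (by simpa [h0] using this)
  refine ⟨d, hdpos, fun htop => ?_, fun x => ?_⟩
  · refine Nat.find_min hN (m := d - 1) (by omega) fun k hk => ?_
    rcases lt_or_eq_of_le (show (d : ℤ) ≤ |k| by omega) with h | h
    · exact hd k h
    · rcases abs_choice k with hk' | hk'
      · rw [← hk', ← h, htop]
      · rw [← neg_neg k, ← hk', ← h, fc_neg, htop, map_zero]
  · rw [hrep x]
    symm
    refine Finset.sum_bij (fun l _ => (d : ℤ) - l) (fun l hl => ?_) (fun a _ b _ h => by omega)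
      (fun k hk => ?_) (fun l _ => by push_cast; rfl)
    · rw [Finset.mem_range] at hl
      rw [Finset.mem_Icc]
      omega
    · rw [Finset.mem_Icc] at hk
      exact ⟨(d - k).toNat, by rw [Finset.mem_range]; omega, by omega⟩

/-- The Fourier coefficients of a second difference with rational step vanish at resonant
indices. -/
lemma fc_secondDifference_eq_zero {u f : ℝ → ℝ} (hu : Continuous u) (hper : ∀ x, u (x + 1) = u x)
    {ω : ℝ} (h : ∀ θ, u (θ + ω) - 2 * u θ + u (θ - ω) = f θ) {k : ℤ} {a : ℤ} (hk : k * ω = a) :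
    fc f k = 0 := by
  set e : ℝ → ℂ := fun t => Complex.exp (-(2 * Real.pi * Complex.I * k * t)) with he
  have hadd : ∀ t : ℝ, ∀ c : ℤ, e (t + c * ω) = e t := by
    intro t c
    have h1 : (k : ℂ) * ω = a := by exact_mod_cast hk
    simp only [he]
    rw [Complex.exp_eq_exp_iff_exists_int]
    refine ⟨-(a * c), ?_⟩
    push_cast
    linear_combination (-2 * Real.pi * Complex.I * c) * h1
  have hadd1 : ∀ t, e (t + ω) = e t := fun t => by simpa using hadd t 1
  have hsub1 : ∀ t, e (t - ω) = e t := fun t => by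
    simpa [sub_eq_add_neg] using hadd t (-1)
  have hper1 : ∀ t, e (t + 1) = e t := fun t => by
    simp only [he]
    rw [Complex.exp_eq_exp_iff_exists_int]
    refine ⟨-k, ?_⟩
    push_cast
    ring
  set g : ℝ → ℂ := fun t => (u t : ℂ) * e t with hg
  have hgc : Continuous g := by fun_prop
  have hgper : Function.Periodic g 1 := fun t => by simp only [hg, hper, hper1]
  have hshift : ∀ c : ℝ, ∫ t in (0 : ℝ)..1, g (t + c) = ∫ t in (0 : ℝ)..1, g t := by
    intro c
    rw [intervalIntegral.integral_comp_add_right]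
    have := hgper.intervalIntegral_add_eq c 0
    simpa [add_comm] using this
  have hint : ∀ c : ℝ, IntervalIntegrable (fun t => g (t + c)) MeasureTheory.volume 0 1 :=
    fun c => (hgc.comp (continuous_add_const c)).intervalIntegrable _ _
  have hfe : ∀ t : ℝ, (f t : ℂ) * e t = g (t + ω) - 2 * g (t + 0) + g (t + -ω) := by
    intro t
    rw [add_zero, ← sub_eq_add_neg]
    simp only [hg, hadd1, hsub1, ← h t]
    push_cast
    ring
  change ∫ t in (0 : ℝ)..1, (f t : ℂ) * e t = 0
  simp_rw [hfe]
  rw [intervalIntegral.integral_add (((hint _).sub ((hint _).const_mul 2))) (hint _),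
    intervalIntegral.integral_sub (hint _) ((hint _).const_mul 2),
    intervalIntegral.integral_const_mul, hshift, hshift, hshift]
  ring

end Fourier

/-- Derivatives of real functions given by exponential sums. -/
lemma ofReal_iteratedDeriv_of_expSum {f : ℝ → ℝ} (hf : ContDiff ℝ ⊤ f) {ι : Type*} {s : Finset ι}
    {b κ : ι → ℂ} (h : ∀ x : ℝ, (f x : ℂ) = ∑ l ∈ s, b l * Complex.exp (κ l * x)) (r : ℕ) (x : ℝ) :
    ((iteratedDeriv r f x : ℝ) : ℂ) = ∑ l ∈ s, b l * κ l ^ r * Complex.exp (κ l * x) := by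
  induction r generalizing x with
  | zero => simpa using h x
  | succ r ih =>
    have h1 : HasDerivAt (fun y : ℝ => ((iteratedDeriv r f y : ℝ) : ℂ))
        ((iteratedDeriv (r + 1) f x : ℝ) : ℂ) x := by
      rw [iteratedDeriv_succ]
      exact ((hf.differentiable_iteratedDeriv r (by exact_mod_cast WithTop.coe_lt_top _))
        x).hasDerivAt.ofReal_comp
    have h2 : HasDerivAt (fun y : ℝ => ∑ l ∈ s, b l * κ l ^ r * Complex.exp (κ l * y))
        (∑ l ∈ s, b l * κ l ^ (r + 1) * Complex.exp (κ l * x)) x := by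
      refine HasDerivAt.fun_sum fun l _ => ?_
      have h3 := ((((hasDerivAt_id (x : ℂ)).const_mul (κ l)).cexp).const_mul
        (b l * κ l ^ r)).comp_ofReal
      refine h3.congr_deriv ?_
      simp only [id]
      ring
    simp_rw [ih] at h1
    exact h1.unique h2

lemma coeff_pow_eq_sum_antidiagonalTuple {R : Type*} [CommSemiring R] (φ : PowerSeries R)
    (r n : ℕ) : PowerSeries.coeff n (φ ^ r) =
      ∑ c ∈ Finset.Nat.antidiagonalTuple r n, ∏ i, PowerSeries.coeff (c i) φ := by
  have h : φ ^ r = ∏ _i : Fin r, φ := by simp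
  rw [h, PowerSeries.coeff_prod]
  refine Finset.sum_bij (fun l _ => (l : Fin r → ℕ)) (fun l hl => ?_)
    (fun a _ b _ hab => DFunLike.coe_injective hab) (fun c hc => ?_) (fun _ _ => rfl)
  · rw [Finset.mem_finsuppAntidiag] at hl
    exact Finset.Nat.mem_antidiagonalTuple.2 hl.1
  · refine ⟨Finsupp.equivFunOnFinite.symm c, ?_, rfl⟩
    rw [Finset.mem_finsuppAntidiag]
    exact ⟨Finset.Nat.mem_antidiagonalTuple.1 hc, Finset.subset_univ _⟩

/-- The right-hand side of the equation for a trigonometric polynomial nonlinearity, as a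
coefficient of an exponential sum. -/
lemma ofReal_rhsCoeff_succ {f : ℝ → ℝ} (hf : ContDiff ℝ ⊤ f) {ι : Type*} {s : Finset ι} {b κ : ι → ℂ}
    (h : ∀ x : ℝ, (f x : ℂ) = ∑ l ∈ s, b l * Complex.exp (κ l * x)) (u : ℕ → ℝ → ℝ) (hu : u 0 = 0)
    {n N : ℕ} (hn : n + 1 ≤ N) (θ : ℝ) :
    (rhsCoeff f u (n + 1) θ : ℂ) = PowerSeries.coeff n (∑ l ∈ s, (b l * Complex.exp (κ l * θ)) •
      truncExp ℂ N (κ l • PowerSeries.mk fun i => (u i θ : ℂ))) := by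
  set U := PowerSeries.mk fun i => (u i θ : ℂ) with hU
  have hUX : PowerSeries.X ∣ U := by
    rw [PowerSeries.X_dvd_iff, ← PowerSeries.coeff_zero_eq_constantCoeff_apply, hU,
      PowerSeries.coeff_mk, hu]
    simp
  have h1 : (rhsCoeff f u (n + 1) θ : ℂ) = ∑ r ∈ Finset.range (n + 1),
      ((r.factorial : ℂ))⁻¹ * ((iteratedDeriv r f θ : ℝ) : ℂ) * PowerSeries.coeff n (U ^ r) := by
    simp [rhsCoeff, coeff_pow_eq_sum_antidiagonalTuple, hU]
  have h2 : ∑ r ∈ Finset.range (n + 1),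
      ((r.factorial : ℂ))⁻¹ * ((iteratedDeriv r f θ : ℝ) : ℂ) * PowerSeries.coeff n (U ^ r) =
      ∑ r ∈ Finset.range N,
      ((r.factorial : ℂ))⁻¹ * ((iteratedDeriv r f θ : ℝ) : ℂ) * PowerSeries.coeff n (U ^ r) := by
    refine Finset.sum_subset (Finset.range_mono hn) fun r _ hr => ?_
    rw [PowerSeries.X_pow_dvd_iff.1 (pow_dvd_pow_of_dvd hUX r) n (by simpa using hr), mul_zero]
  rw [h1, h2, map_sum]
  simp_rw [ofReal_iteratedDeriv_of_expSum hf h, truncExp, Finset.smul_sum, map_sum, map_smul,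
    Finset.mul_sum, Finset.sum_mul]
  rw [Finset.sum_comm]
  refine Finset.sum_congr rfl fun l _ => Finset.sum_congr rfl fun r _ => ?_
  rw [smul_pow, map_smul]
  simp only [smul_eq_mul]
  ring

/-- The vertical translation factor in the multiplicative change of variables `w ↦ s + w` for an
exponential sum whose frequencies form an arithmetic progression. -/
lemma dvd_smul_truncExp_add_sub {A : Type*} [CommRing A] [Algebra ℂ A] {x s v : A} (hs : x ∣ s)
    (hv : x ∣ v) {N : ℕ} (hN : 0 < N) (κ₀ δ e₀ e₁ b : ℂ) (l : ℕ) :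
    x ^ N ∣ (b * (e₀ * e₁ ^ l)) • truncExp ℂ N ((κ₀ + l * δ) • (s + v)) -
      (e₀ • truncExp ℂ N (κ₀ • s)) *
        b • ((e₁ • truncExp ℂ N (δ • s)) ^ l * truncExp ℂ N ((κ₀ + l * δ) • v)) := by
  have hsv : (κ₀ + l * δ) • (s + v) = (κ₀ • s + l • (δ • s)) + (κ₀ + l * δ) • v := by
    rw [smul_add, add_smul, mul_smul, Nat.cast_smul_eq_nsmul]
  have hs0 : x ∣ κ₀ • s := dvd_smul_of_dvd _ hs
  have hs1 : x ∣ δ • s := dvd_smul_of_dvd _ hs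
  have hsl : x ∣ l • (δ • s) := dvd_smul_of_dvd _ hs1
  have hvl : x ∣ (κ₀ + l * δ) • v := dvd_smul_of_dvd _ hv
  have h1 := dvd_truncExp_add_sub (K := ℂ) N (hs0.add hsl) hvl
  have h2 := dvd_truncExp_add_sub (K := ℂ) N hs0 hsl
  have h3 := dvd_truncExp_nsmul_sub (K := ℂ) hN hs1 l
  rw [hsv]
  set V := truncExp ℂ N ((κ₀ + l * δ) • v)
  have h4 := ((h1.add (h2.mul_right V)).add
    ((h3.mul_left (truncExp ℂ N (κ₀ • s))).mul_right V)).mul_left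
      (algebraMap ℂ A (b * (e₀ * e₁ ^ l)))
  convert h4 using 1
  simp only [Algebra.smul_def, map_mul, map_pow]
  ring

lemma constantCoeff_truncExp {N : ℕ} (hN : 0 < N) {s : PowerSeries ℂ} (hs : PowerSeries.X ∣ s) :
    PowerSeries.constantCoeff (truncExp ℂ N s) = 1 := by
  rw [map_truncExp (K := ℂ) ℂ, PowerSeries.X_dvd_iff.1 hs, truncExp_zero hN]

lemma infinite_range_exp_neg :
    (Set.range fun t : ℝ => Complex.exp (-(2 * Real.pi * Complex.I) * t)).Infinite := by
  refine (isPreconnected_range (by fun_prop)).infinite_of_nontrivial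
    ⟨_, ⟨0, rfl⟩, _, ⟨1 / 2, rfl⟩, ?_⟩
  have : -(2 * Real.pi * Complex.I) * ((1 / 2 : ℝ) : ℂ) = -(Real.pi * Complex.I) := by
    push_cast
    ring
  simp only [this]
  rw [Complex.exp_neg, Complex.exp_pi_mul_I]
  norm_num

/-- A periodic function sampled along a rational rotation. -/
lemma sample_add_one {α : Type*} {g : ℝ → α} (hg : Function.Periodic g 1) (p : ℤ) (m : ℕ)
    [NeZero m] (θ : ℝ) (j : ZMod m) :
    g (θ + (j + 1).val * ((p : ℝ) / m)) = g (θ + j.val * ((p : ℝ) / m) + (p : ℝ) / m) := by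
  have hm : (m : ℝ) ≠ 0 := Nat.cast_ne_zero.2 (NeZero.ne m)
  obtain ⟨c, hc⟩ : ∃ c : ℕ, j.val + 1 = (j + 1).val + m * c := by
    refine ⟨(j.val + 1) / m, ?_⟩
    have h : (j + 1).val = (j.val + 1) % m := by
      rw [ZMod.val_add, ZMod.val_one_eq_one_mod, Nat.add_mod_mod]
    rw [h, Nat.mod_add_div]
  have hc' : (j.val : ℝ) + 1 = (j + 1).val + m * c := by exact_mod_cast hc
  have h : θ + j.val * ((p : ℝ) / m) + (p : ℝ) / m =
      θ + (j + 1).val * ((p : ℝ) / m) + ((c * p : ℤ) : ℝ) * 1 := by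
    have h2 : θ + j.val * ((p : ℝ) / m) + (p : ℝ) / m =
      θ + ((j.val : ℝ) + 1) * ((p : ℝ) / m) := by ring
    rw [h2, hc']
    push_cast
    field_simp
    ring
  rw [h, hg.int_mul]

/-- The equation has no formal solution at a rational frequency if `f` is a trigonometric
polynomial of positive degree. -/
lemma no_formal_solution_of_top_harmonic (p : ℤ) (m : ℕ) [NeZero m] {f : ℝ → ℝ}
    (hf : ContDiff ℝ ⊤ f) {d : ℕ} (hd : 0 < d) {b : ℕ → ℂ} (hb : b 0 ≠ 0)
    (hfb : ∀ x : ℝ, (f x : ℂ) = ∑ l ∈ Finset.range (2 * d + 1),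
      b l * Complex.exp (2 * Real.pi * Complex.I * (d - l) * x))
    {u : ℕ → ℝ → ℝ} (hu0 : u 0 = 0) (huper : ∀ n x, u n (x + 1) = u n x)
    (hu : ∀ n, 1 ≤ n → ∀ θ, u n (θ + (p : ℝ) / m) - 2 * u n θ + u n (θ - (p : ℝ) / m) =
      rhsCoeff f u n θ) : False := by
  have hm : (m : ℂ) ≠ 0 := Nat.cast_ne_zero.2 (NeZero.ne m)
  set ω : ℝ := (p : ℝ) / m with hω
  set κ₀ : ℂ := 2 * Real.pi * Complex.I * d with hκ₀
  set δ : ℂ := -(2 * Real.pi * Complex.I) with hδ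
  let κ : ℕ → ℂ := fun l => κ₀ + l * δ
  set η : ℂ := Complex.exp (κ₀ * ω) with hη
  have hηm : η ^ m = 1 := by
    rw [hη, ← Complex.exp_nat_mul, Complex.exp_eq_one_iff]
    refine ⟨d * p, ?_⟩
    rw [hκ₀, hω]
    push_cast
    field_simp
  set N := orderOf η + 2 with hN
  let γ : ZMod m → ℕ → ℂ := fun j l => b l * Complex.exp (κ l * (j.val * ω : ℝ))
  let U : ℝ → PowerSeries ℂ := fun x => PowerSeries.mk fun i => (u i x : ℂ)
  have hUper : Function.Periodic U 1 := fun x => by simp [U, huper]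
  have hUX : ∀ x, PowerSeries.X ∣ U x := fun x => by
    rw [PowerSeries.X_dvd_iff, ← PowerSeries.coeff_zero_eq_constantCoeff_apply,
      PowerSeries.coeff_mk, hu0]
    simp
  have hfκ : ∀ x : ℝ, (f x : ℂ) = ∑ l ∈ Finset.range (2 * d + 1),
      b l * Complex.exp (κ l * x) := fun x => by
    rw [hfb x]
    refine Finset.sum_congr rfl fun l _ => ?_
    congr 3
    simp only [κ, hκ₀, hδ]
    ring
  have hUeq : ∀ x, PowerSeries.X ^ N ∣ U (x + ω) - U x - (U x - U (x - ω)) -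
      PowerSeries.X * ∑ l ∈ Finset.range (2 * d + 1), (b l * Complex.exp (κ l * x)) •
        truncExp ℂ N (κ l • U x) := by
    intro x
    rw [PowerSeries.X_pow_dvd_iff]
    intro n hn
    cases n with
    | zero =>
      rw [map_sub, PowerSeries.coeff_zero_X_mul]
      simp only [U, map_sub, PowerSeries.coeff_mk, hu0]
      simp
    | succ n =>
      rw [map_sub, PowerSeries.coeff_succ_X_mul,
        ← ofReal_rhsCoeff_succ hf hfκ u hu0 (n := n) (by omega), ← hu (n + 1) (by omega) x]
      simp only [U, map_sub, PowerSeries.coeff_mk]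
      push_cast
      ring
  let W : ℝ → ZMod m → PowerSeries ℂ := fun θ j => U (θ + j.val * ω)
  let s : ℝ → PowerSeries ℂ := fun θ => (m : ℂ)⁻¹ • ∑ j, W θ j
  have hsX : ∀ θ, PowerSeries.X ∣ s θ := fun θ =>
    dvd_smul_of_dvd _ (Finset.dvd_sum fun j _ => hUX _)
  have hN0 : 0 < N := by omega
  have hWsucc : ∀ θ j, W θ (j + 1) = U (θ + j.val * ω + ω) := fun θ j =>
    sample_add_one hUper p m θ j
  have hWpred : ∀ θ j, W θ (j - 1) = U (θ + j.val * ω - ω) := fun θ j => by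
    have hper' : Function.Periodic (fun x => U (x - ω)) 1 := fun x => by
      simp only [add_sub_right_comm, hUper (x - ω)]
    have h := sample_add_one hper' p m θ (j - 1)
    rw [sub_add_cancel, ← hω, add_sub_cancel_right] at h
    exact h.symm
  refine no_normalised_cyclic_family (m := m) hηm hb γ κ (fun j => ?_) ?_ (L := 2 * d + 1)
    (N := N) (by omega) (by omega)
    (fun θ : ℝ => Complex.exp (δ * θ) • truncExp ℂ N (δ • s θ))
    (fun θ : ℝ => PowerSeries.X * (Complex.exp (κ₀ * θ) • truncExp ℂ N (κ₀ • s θ))) ?_ ?_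
    (fun θ j => W θ j - s θ) ?_ ?_
  · simp only [γ, κ, hη]
    rw [← Complex.exp_nat_mul]
    congr 2
    push_cast
    ring
  · simp only [κ, Nat.cast_zero, zero_mul, add_zero, hκ₀]
    exact mul_ne_zero Complex.two_pi_I_ne_zero (Nat.cast_ne_zero.2 hd.ne')
  · refine infinite_range_exp_neg.mono ?_
    rintro _ ⟨θ, rfl⟩
    refine ⟨θ, ?_⟩
    simp only
    rw [PowerSeries.smul_eq_C_mul, map_mul, constantCoeff_truncExp hN0 (dvd_smul_of_dvd _ (hsX θ)),
      PowerSeries.constantCoeff_C, mul_one]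
  · intro θ
    refine associated_mul_unit_right _ _ (PowerSeries.isUnit_iff_constantCoeff.2 ?_)
    rw [PowerSeries.smul_eq_C_mul, map_mul, constantCoeff_truncExp hN0 (dvd_smul_of_dvd _ (hsX θ)),
      PowerSeries.constantCoeff_C, mul_one]
    exact (Complex.exp_ne_zero _).isUnit
  · intro θ
    rw [Finset.sum_sub_distrib, Finset.sum_const, Finset.card_univ, ZMod.card]
    simp only [s]
    rw [← Nat.cast_smul_eq_nsmul ℂ, smul_smul, mul_inv_cancel₀ hm, one_smul, sub_self]
  · intro θ j
    set Z := Complex.exp (κ₀ * θ) • truncExp ℂ N (κ₀ • s θ)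
    set Y := Complex.exp (δ * θ) • truncExp ℂ N (δ • s θ)
    have h1 : PowerSeries.X ^ N ∣ ∑ l ∈ Finset.range (2 * d + 1),
        (b l * Complex.exp (κ l * (θ + j.val * ω : ℝ))) • truncExp ℂ N (κ l • W θ j) -
        Z * expSum γ κ (2 * d + 1) N Y j (W θ j - s θ) := by
      rw [expSum, Finset.mul_sum, ← Finset.sum_sub_distrib]
      refine Finset.dvd_sum fun l _ => ?_
      have h := dvd_smul_truncExp_add_sub (hsX θ) (dvd_sub (hUX (θ + j.val * ω)) (hsX θ)) hN0
        κ₀ δ (Complex.exp (κ₀ * θ)) (Complex.exp (δ * θ)) (γ j l) l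
      rw [add_sub_cancel] at h
      convert h using 3
      simp only [γ, κ]
      rw [← Complex.exp_nat_mul, mul_assoc, ← Complex.exp_add, ← Complex.exp_add]
      congr 2
      push_cast
      ring
    have h2 := (hUeq (θ + j.val * ω)).add (h1.mul_left PowerSeries.X)
    refine (pow_dvd_pow PowerSeries.X (Nat.le_succ (orderOf η + 1))).trans ?_
    convert h2 using 1
    simp only [cyclicLaplacian, hWsucc, hWpred, W]
    ring

/-- Let `ω* = p/m` be rational and let `f` be analytic on `𝕋`
with zero mean value, which is either a non-zero trigonometric polynomial or has
a non-zero Fourier coefficient of index `k ∈ mℤ`. Then the difference equation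
`u(θ+ω*,ε) − 2u(θ,ε) + u(θ−ω*,ε) = εf(θ+u(θ,ε))` has no solution which is a
formal power series `u = Σ_{n≥1} ε^n u_n` in `ε` with coefficients `u_n`
analytic on `𝕋`. -/
theorem no_formal_solution_at_rational (p : ℤ) (m : ℕ) (hm : 0 < m) (f : ℝ → ℝ)
    (hfa : ∀ x : ℝ, AnalyticAt ℝ f x)
    (hfper : ∀ x : ℝ, f (x + 1) = f x)
    (hfmean : (∫ t in (0:ℝ)..1, f t) = 0)
    (hf : ((∃ N : ℕ, ∀ k : ℤ, (N : ℤ) < |k| → fc f k = 0) ∧ ∃ x : ℝ, f x ≠ 0) ∨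
          (∃ k : ℤ, (m : ℤ) ∣ k ∧ fc f k ≠ 0)) :
    ¬ ∃ u : ℕ → ℝ → ℝ,
        u 0 = 0 ∧
        (∀ n : ℕ, ∀ x : ℝ, AnalyticAt ℝ (u n) x) ∧
        (∀ n : ℕ, ∀ x : ℝ, u n (x + 1) = u n x) ∧
        (∀ n : ℕ, 1 ≤ n → ∀ θ : ℝ,
          u n (θ + (p : ℝ) / m) - 2 * u n θ + u n (θ - (p : ℝ) / m) =
            rhsCoeff f u n θ) := by
  rintro ⟨u, hu0, hua, huper, hu⟩
  have : NeZero m := ⟨hm.ne'⟩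
  have hfs : ContDiff ℝ ⊤ f := AnalyticOnNhd.contDiff fun x _ => hfa x
  rcases hf with ⟨hN, hne⟩ | ⟨k, ⟨a, rfl⟩, hk⟩
  · obtain ⟨d, hd, hfd, hrep⟩ := exists_top_harmonic hfs.continuous hfper hfmean hN hne
    exact no_formal_solution_of_top_harmonic p m hfs hd (b := fun l => fc f (d - l))
      (by simpa using hfd) hrep hu0 huper hu
  · have hu1 : Continuous (u 1) :=
      continuous_iff_continuousAt.2 fun x => (hua 1 x).continuousAt
    refine hk (fc_secondDifference_eq_zero hu1 (huper 1) (ω := (p : ℝ) / m) (fun θ => ?_)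
      (a := a * p) ?_)
    · rw [hu 1 le_rfl θ]
      simp [rhsCoeff]
    · push_cast
      field_simp
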